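/- arXiv:1805.06063 — 4 statements merged into one kernel-verified Lean document; each statement's English description precedes it below -/
import Mathlib

section
/- Let S_1,…,S_N be a representation of the Cuntz algebra 𝒪_N on ℋ. A bounded operator T on ℋ commutes with every S_i and every S_i* (1 ≤ i ≤ N) if and only if β_π(T) = T, i.e., ∑_{i=1}^N S_i T S_i* = T. In other words, the commutant of the representation equals the fixed-point set of the endomorphism β_π. -/
open ContinuousLinearMap

/-- For a representation of the Cuntz algebra `𝒪_N` on `ℋ`, a bounded operator `T`
commutes with every `S_i` and every `S_i^*` if and only if
`β_π(T) = ∑_{i=1}^N S_i T S_i^* = T`; i.e. the commutant of the representation equals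
the fixed-point set of the endomorphism `β_π`. -/
theorem cuntz_commutant_eq_fixed_points
    {H : Type*} [NormedAddCommGroup H] [InnerProductSpace ℂ H] [CompleteSpace H]
    (N : ℕ) (hN : 2 ≤ N) (S : Fin N → H →L[ℂ] H)
    (hiso : ∀ i j, adjoint (S i) * S j = if i = j then 1 else 0)
    (hsum : ∑ i, S i * adjoint (S i) = 1)
    (T : H →L[ℂ] H) :
    (∀ i : Fin N, T * S i = S i * T ∧ T * adjoint (S i) = adjoint (S i) * T) ↔
      ∑ i : Fin N, S i * T * adjoint (S i) = T := by
  constructor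
  · intro h
    calc ∑ i : Fin N, S i * T * adjoint (S i)
        = ∑ i : Fin N, T * (S i * adjoint (S i)) :=
          Finset.sum_congr rfl fun i _ => by rw [← (h i).1, mul_assoc]
      _ = T := by rw [← Finset.mul_sum, hsum, mul_one]
  · intro h i
    constructor
    · calc T * S i = (∑ j : Fin N, S j * T * adjoint (S j)) * S i := by rw [h]
        _ = ∑ j : Fin N, S j * T * (if j = i then 1 else 0) := by
          rw [Finset.sum_mul]
          exact Finset.sum_congr rfl fun j _ => by rw [mul_assoc, hiso]
        _ = S i * T := by simp
    · symm
      calc adjoint (S i) * T = adjoint (S i) * (∑ j : Fin N, S j * T * adjoint (S j)) := by rw [h]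
        _ = ∑ j : Fin N, (if i = j then 1 else 0) * (T * adjoint (S j)) := by
          rw [Finset.mul_sum]
          exact Finset.sum_congr rfl fun j _ => by rw [← hiso]; simp only [mul_assoc]
        _ = T * adjoint (S i) := by simp
end

section
/- Let S_1,…,S_N be a representation of the Cuntz algebra 𝒪_N on ℋ. There exists a unique projection-valued measure Q_π on (Ω_N, 𝒞) with values in the orthogonal projections on ℋ such that Q_π(E_f) = S_f S_f* for every nonempty finite word f in the alphabet {1,…,N}. -/
open ContinuousLinearMap Filter Topology

/-- `S_f = S_{i₁} S_{i₂} ⋯ S_{i_k}` for a finite word `f = (i₁,…,i_k)`. -/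
noncomputable def SWord {H : Type*} [NormedAddCommGroup H] [InnerProductSpace ℂ H]
    {N : ℕ} (S : Fin N → H →L[ℂ] H) (f : List (Fin N)) : H →L[ℂ] H :=
  (f.map S).prod

/-- The cylinder set `E_f = {ω : ω_j = f_j for j < |f|}` of a finite word `f`. -/
def cylinder {N : ℕ} (f : List (Fin N)) : Set (ℕ → Fin N) :=
  {ω | ∀ j : Fin f.length, ω j = f.get j}

/-- The σ-algebra `𝒞` on `Ω_N` generated by cylinder sets of nonempty finite words. -/
def cylinderSigma (N : ℕ) : MeasurableSpace (ℕ → Fin N) :=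
  MeasurableSpace.generateFrom {E | ∃ f : List (Fin N), f ≠ [] ∧ E = cylinder f}

/-- A projection-valued measure on `(Ω_N, 𝒞)`: projection values on measurable sets,
`Q(∅) = 0`, `Q(Ω_N) = I`, and countable additivity in the strong operator topology. -/
def IsProjValuedMeasure {H : Type*} [NormedAddCommGroup H] [InnerProductSpace ℂ H]
    [CompleteSpace H] {N : ℕ} (Q : Set (ℕ → Fin N) → H →L[ℂ] H) : Prop :=
  (∀ E, @MeasurableSet _ (cylinderSigma N) E → IsSelfAdjoint (Q E) ∧ Q E * Q E = Q E) ∧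
  Q ∅ = 0 ∧ Q Set.univ = 1 ∧
  ∀ E : ℕ → Set (ℕ → Fin N), (∀ n, @MeasurableSet _ (cylinderSigma N) (E n)) →
    Pairwise (Function.onFun Disjoint E) →
    ∀ h : H, HasSum (fun n => Q (E n) h) (Q (⋃ n, E n) h)


section CuntzAux

/-- Prepend a letter to an infinite word. -/
def consW {N : ℕ} (i : Fin N) (ω : ℕ → Fin N) : ℕ → Fin N := fun n => Nat.casesOn n i ω

theorem measurable_consW {N : ℕ} (i : Fin N) : Measurable (consW i) := by
  rw [measurable_pi_iff]
  intro n
  cases n with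
  | zero => exact measurable_const
  | succ n => exact measurable_pi_apply n

theorem cylinder_nil {N : ℕ} : cylinder ([] : List (Fin N)) = Set.univ := by
  ext ω; simp [cylinder]

theorem mem_cylinder_cons {N : ℕ} (i : Fin N) (f : List (Fin N)) (ω : ℕ → Fin N) :
    ω ∈ cylinder (i :: f) ↔ ω 0 = i ∧ (fun n => ω (n + 1)) ∈ cylinder f := by
  simp only [cylinder, Set.mem_ofPred_eq]
  constructor
  · intro h
    exact ⟨h ⟨0, by simp⟩, fun j => h ⟨j + 1, by simp⟩⟩
  · rintro ⟨h0, h1⟩ ⟨j, hj⟩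
    cases j with
    | zero => exact h0
    | succ j => exact h1 ⟨j, by simpa using hj⟩

theorem preimage_consW {N : ℕ} (j i : Fin N) (f : List (Fin N)) :
    consW j ⁻¹' cylinder (i :: f) = if j = i then cylinder f else ∅ := by
  ext ω
  rw [Set.mem_preimage, mem_cylinder_cons]
  split_ifs with h
  · exact ⟨fun h => h.2, fun h' => ⟨h, h'⟩⟩
  · simp only [Set.mem_empty_iff_false, iff_false]
    exact fun h' => h h'.1

theorem isClopen_cylinder {N : ℕ} (f : List (Fin N)) : IsClopen (cylinder f) := by
  have : cylinder f = ⋂ j : Fin f.length, (fun ω : ℕ → Fin N => ω j) ⁻¹' {f.get j} := by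
    ext ω; simp [cylinder]
  rw [this]
  exact isClopen_iInter_of_finite fun j =>
    (isClopen_discrete _).preimage (continuous_apply _)

theorem measurableSet_cylinder {N : ℕ} (f : List (Fin N)) : MeasurableSet (cylinder f) :=
  (isClopen_cylinder f).isOpen.measurableSet

theorem cylinder_inter {N : ℕ} (f g : List (Fin N)) :
    cylinder f ∩ cylinder g = ∅ ∨ cylinder f ∩ cylinder g = cylinder f ∨
      cylinder f ∩ cylinder g = cylinder g := by
  have key : ∀ f g : List (Fin N), f.length ≤ g.length → (cylinder f ∩ cylinder g).Nonempty →
      cylinder g ⊆ cylinder f := by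
    rintro f g hl ⟨ω, hf, hg⟩ η hη j
    have h1 := hf j
    have h2 := hg ⟨j, lt_of_lt_of_le j.2 hl⟩
    have h3 := hη ⟨j, lt_of_lt_of_le j.2 hl⟩
    rw [← h1]
    exact h3.trans h2.symm
  rcases Set.eq_empty_or_nonempty (cylinder f ∩ cylinder g) with h | h
  · exact Or.inl h
  · right
    rcases le_total f.length g.length with hl | hl
    · right
      exact Set.inter_eq_right.2 (key f g hl h)
    · left
      exact Set.inter_eq_left.2 (key g f hl (by rwa [Set.inter_comm]))

theorem cylinderSigma_le (N : ℕ) : cylinderSigma N ≤ MeasurableSpace.pi := by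
  refine MeasurableSpace.generateFrom_le ?_
  rintro _ ⟨f, -, rfl⟩
  exact measurableSet_cylinder f

theorem isPiSystem_cyl (N : ℕ) :
    IsPiSystem {E : Set (ℕ → Fin N) | ∃ f : List (Fin N), f ≠ [] ∧ E = cylinder f} := by
  rintro _ ⟨f, hf, rfl⟩ _ ⟨g, hg, rfl⟩ h
  rcases cylinder_inter f g with h' | h' | h'
  · exact absurd h' h.ne_empty
  · exact ⟨f, hf, h'⟩
  · exact ⟨g, hg, h'⟩

variable {H : Type*} [NormedAddCommGroup H] [InnerProductSpace ℂ H] [CompleteSpace H]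

/-- Approximating measures. -/
noncomputable def muApprox {N : ℕ} (S : Fin N → H →L[ℂ] H) (i₀ : Fin N) :
    ℕ → H → MeasureTheory.Measure (ℕ → Fin N)
  | 0, h => ENNReal.ofReal (‖h‖ ^ 2) • MeasureTheory.Measure.dirac (fun _ => i₀)
  | n + 1, h => ∑ i, (muApprox S i₀ n (adjoint (S i) h)).map (consW i)

theorem inner_self_C (x : H) : inner ℂ x x = ((‖x‖ ^ 2 : ℝ) : ℂ) := by
  rw [inner_self_eq_norm_sq_to_K]; norm_cast

theorem sum_norm_sq {N : ℕ} (S : Fin N → H →L[ℂ] H)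
    (hsum : ∑ i, S i * adjoint (S i) = 1) (h : H) :
    ∑ i, ‖adjoint (S i) h‖ ^ 2 = ‖h‖ ^ 2 := by
  have h1 : inner ℂ h ((∑ i, S i * adjoint (S i)) h) = inner ℂ h h := by rw [hsum]; rfl
  have h2 : ∀ i, inner ℂ h ((S i * adjoint (S i)) h) = ((‖adjoint (S i) h‖ ^ 2 : ℝ) : ℂ) := by
    intro i
    rw [← inner_self_C, ContinuousLinearMap.adjoint_inner_left]
    rfl
  rw [_root_.sum_apply, inner_sum, inner_self_C] at h1
  simp only [h2] at h1
  exact_mod_cast h1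

theorem muApprox_univ {N : ℕ} (S : Fin N → H →L[ℂ] H) (i₀ : Fin N)
    (hsum : ∑ i, S i * adjoint (S i) = 1) (n : ℕ) (h : H) :
    muApprox S i₀ n h Set.univ = ENNReal.ofReal (‖h‖ ^ 2) := by
  induction n generalizing h with
  | zero => simp [muApprox]
  | succ n ih =>
    simp only [muApprox, MeasureTheory.Measure.finsetSum_apply]
    rw [← sum_norm_sq S hsum h, ENNReal.ofReal_sum_of_nonneg (fun i _ => by positivity)]
    refine Finset.sum_congr rfl fun i _ => ?_
    rw [MeasureTheory.Measure.map_apply (measurable_consW i) MeasurableSet.univ, Set.preimage_univ, ih]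

theorem SWord_cons {N : ℕ} (S : Fin N → H →L[ℂ] H) (i : Fin N) (f : List (Fin N)) :
    SWord S (i :: f) = S i * SWord S f := by simp [SWord]

theorem adjoint_SWord_cons {N : ℕ} (S : Fin N → H →L[ℂ] H) (i : Fin N) (f : List (Fin N)) (h : H) :
    adjoint (SWord S (i :: f)) h = adjoint (SWord S f) (adjoint (S i) h) := by
  rw [SWord_cons, ContinuousLinearMap.mul_def, ContinuousLinearMap.adjoint_comp]; rfl

theorem muApprox_cylinder {N : ℕ} (S : Fin N → H →L[ℂ] H) (i₀ : Fin N)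
    (hsum : ∑ i, S i * adjoint (S i) = 1) (f : List (Fin N)) (n : ℕ) (hn : f.length ≤ n) (h : H) :
    muApprox S i₀ n h (cylinder f) = ENNReal.ofReal (‖adjoint (SWord S f) h‖ ^ 2) := by
  induction f generalizing n h with
  | nil =>
    rw [cylinder_nil, muApprox_univ S i₀ hsum]
    have : adjoint (SWord S ([] : List (Fin N))) = 1 := by
      simp [SWord, ← ContinuousLinearMap.star_eq_adjoint]
    rw [this]; rfl
  | cons i f ih =>
    obtain _ | n := n
    · simp at hn
    simp only [muApprox, MeasureTheory.Measure.finsetSum_apply]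
    rw [Finset.sum_eq_single i]
    · rw [MeasureTheory.Measure.map_apply (measurable_consW i) (measurableSet_cylinder _),
        preimage_consW, if_pos rfl, ih n (by simpa using hn), adjoint_SWord_cons]
    · intro j _ hj
      rw [MeasureTheory.Measure.map_apply (measurable_consW j) (measurableSet_cylinder _),
        preimage_consW, if_neg hj, MeasureTheory.measure_empty]
    · simp

theorem exists_mu_unit {N : ℕ} (S : Fin N → H →L[ℂ] H) (i₀ : Fin N)
    (hsum : ∑ i, S i * adjoint (S i) = 1) (h : H) (hh : ‖h‖ = 1) :
    ∃ μ : MeasureTheory.Measure (ℕ → Fin N), ∀ f : List (Fin N),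
      μ (cylinder f) = ENNReal.ofReal (‖adjoint (SWord S f) h‖ ^ 2) := by
  let ν : ℕ → MeasureTheory.ProbabilityMeasure (ℕ → Fin N) := fun n =>
    ⟨muApprox S i₀ n h, ⟨by rw [muApprox_univ S i₀ hsum, hh]; simp⟩⟩
  let U : Ultrafilter (MeasureTheory.ProbabilityMeasure (ℕ → Fin N)) := (hyperfilter ℕ).map ν
  obtain ⟨μ, -, hμ⟩ := isCompact_univ.ultrafilter_le_nhds U (by simp)
  have ht : Tendsto ν (hyperfilter ℕ) (𝓝 μ) := hμ
  refine ⟨μ, fun f => ?_⟩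
  have h1 := MeasureTheory.ProbabilityMeasure.tendsto_measure_of_null_frontier_of_tendsto' ht
    (E := cylinder f) (by rw [(isClopen_cylinder f).frontier_eq]; simp)
  refine tendsto_nhds_unique h1 (tendsto_const_nhds.congr' ?_)
  have h2 : ∀ᶠ n in atTop, ENNReal.ofReal (‖adjoint (SWord S f) h‖ ^ 2) =
      (ν n : MeasureTheory.Measure (ℕ → Fin N)) (cylinder f) := by
    filter_upwards [eventually_ge_atTop f.length] with n hn
    exact (muApprox_cylinder S i₀ hsum f n hn h).symm
  exact h2.filter_mono Nat.hyperfilter_le_atTop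

theorem exists_mu {N : ℕ} (S : Fin N → H →L[ℂ] H) (i₀ : Fin N)
    (hsum : ∑ i, S i * adjoint (S i) = 1) (h : H) :
    ∃ μ : MeasureTheory.Measure (ℕ → Fin N), ∀ f : List (Fin N),
      μ (cylinder f) = ENNReal.ofReal (‖adjoint (SWord S f) h‖ ^ 2) := by
  by_cases h0 : h = 0
  · exact ⟨0, fun f => by simp [h0]⟩
  have hn : ‖h‖ ≠ 0 := by simpa using h0
  obtain ⟨μ, hμ⟩ := exists_mu_unit S i₀ hsum (((‖h‖ : ℂ)⁻¹) • h) (by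
    rw [norm_smul]; simp [hn])
  refine ⟨ENNReal.ofReal (‖h‖ ^ 2) • μ, fun f => ?_⟩
  rw [MeasureTheory.Measure.smul_apply, hμ, smul_eq_mul, ← ENNReal.ofReal_mul (by positivity), map_smul,
    norm_smul, mul_pow, ← mul_assoc]
  congr 1
  simp [hn]

/-- Self-adjoint idempotents. -/
def IsPr (P : H →L[ℂ] H) : Prop := IsSelfAdjoint P ∧ P * P = P

theorem IsPr.inner_eq {P : H →L[ℂ] H} (hP : IsPr P) (x y : H) :
    inner ℂ (P x) y = inner ℂ x (P y) := by
  conv_lhs => rw [← hP.1.adjoint_eq]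
  exact ContinuousLinearMap.adjoint_inner_left _ _ _

theorem IsPr.app {P : H →L[ℂ] H} (hP : IsPr P) (x : H) : P (P x) = P x :=
  congrArg (fun T : H →L[ℂ] H => T x) hP.2

theorem IsPr.norm_sq {P : H →L[ℂ] H} (hP : IsPr P) (x : H) :
    inner ℂ x (P x) = ((‖P x‖ ^ 2 : ℝ) : ℂ) := by
  rw [← hP.app, ← hP.inner_eq, inner_self_eq_norm_sq_to_K, hP.app]; norm_cast

theorem IsPr.ext_norm {P Q : H →L[ℂ] H} (hP : IsPr P) (hQ : IsPr Q)
    (h : ∀ x, ‖P x‖ ^ 2 = ‖Q x‖ ^ 2) : P = Q := by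
  have : (P : H →ₗ[ℂ] H) = Q := by
    rw [← ext_inner_map]
    intro x
    have h1 := hP.norm_sq x
    have h2 := hQ.norm_sq x
    have h3 : inner ℂ (P x) x = inner ℂ (Q x) x := by
      rw [hP.inner_eq, hQ.inner_eq, h1, h2, h]
    exact h3
  ext x
  exact congrArg (fun T : H →ₗ[ℂ] H => T x) this

theorem IsPr.one_sub {P : H →L[ℂ] H} (hP : IsPr P) : IsPr (1 - P) := by
  refine ⟨(IsSelfAdjoint.one _).sub hP.1, ?_⟩
  rw [sub_mul, mul_sub, mul_sub, hP.2]; simp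

theorem IsPr.norm_one_sub {P : H →L[ℂ] H} (hP : IsPr P) (x : H) :
    ‖(1 - P) x‖ ^ 2 + ‖P x‖ ^ 2 = ‖x‖ ^ 2 := by
  have h1 := hP.norm_sq x
  have h2 := hP.one_sub.norm_sq x
  have h3 : inner ℂ x ((1 - P) x) + inner ℂ x (P x) = inner ℂ x x := by
    rw [← inner_add_right]; simp
  rw [h1, h2, inner_self_C] at h3
  exact_mod_cast h3

theorem exists_sum_proj (P : ℕ → H →L[ℂ] H) (hP : ∀ n, IsPr (P n))
    (ho : ∀ m n, m ≠ n → ∀ x, P m (P n x) = 0)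
    (hs : ∀ x, Summable fun n => ‖P n x‖ ^ 2) :
    ∃ T : H →L[ℂ] H, IsPr T ∧ ∀ x, HasSum (fun n => P n x) (T x) := by
  have horth : OrthogonalFamily ℂ (fun n => LinearMap.range (P n : H →ₗ[ℂ] H))
      (fun n => (LinearMap.range (P n : H →ₗ[ℂ] H)).subtypeₗᵢ) := by
    rintro m n hmn ⟨_, x, rfl⟩ ⟨_, y, rfl⟩
    change inner ℂ (P m x) (P n y) = 0
    rw [(hP m).inner_eq, ho m n hmn, inner_zero_right]
  have hsum : ∀ x, Summable fun n => P n x := fun x =>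
    (horth.summable_iff_norm_sq_summable (fun n => ⟨P n x, x, rfl⟩)).2 (hs x)
  have hid : ∀ n x, P n (∑' m, P m x) = P n x := by
    intro n x
    rw [(P n).map_tsum (hsum x), tsum_eq_single n (fun m hm => ho n m hm.symm x), (hP n).app]
  have hsa : ∀ x y, inner ℂ (∑' m, P m x) y = inner ℂ x (∑' m, P m y) := by
    intro x y
    have h1 : HasSum (fun n => inner ℂ x (P n y)) (inner ℂ x (∑' m, P m y)) :=
      (innerSL ℂ x).hasSum (hsum y).hasSum
    have h2 : HasSum (fun n => inner ℂ y (P n x)) (inner ℂ y (∑' m, P m x)) :=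
      (innerSL ℂ y).hasSum (hsum x).hasSum
    have h3 := h2.star
    simp only [RCLike.star_def, inner_conj_symm] at h3
    simp only [(hP _).inner_eq] at h3
    exact h3.unique h1
  have hbd : ∀ x, ‖∑' m, P m x‖ ≤ 1 * ‖x‖ := by
    intro x
    have h1 : inner ℂ (∑' m, P m x) (∑' m, P m x) = inner ℂ x (∑' m, P m x) := by
      rw [hsa]; simp only [hid]
    have h2 : ‖∑' m, P m x‖ ^ 2 ≤ ‖x‖ * ‖∑' m, P m x‖ := by
      have h3 := norm_inner_le_norm (𝕜 := ℂ) x (∑' m, P m x)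
      rw [← h1, inner_self_eq_norm_sq_to_K] at h3
      simpa using h3
    by_contra hc
    push Not at hc
    nlinarith [norm_nonneg x, norm_nonneg (∑' m, P m x)]
  let L : H →ₗ[ℂ] H :=
    { toFun := fun x => ∑' m, P m x
      map_add' := fun x y => by simp only [map_add]; exact (hsum x).tsum_add (hsum y)
      map_smul' := fun c x => by simp only [map_smul]; exact (hsum x).tsum_const_smul c }
  refine ⟨L.mkContinuous 1 hbd, ⟨?_, ?_⟩, fun x => (hsum x).hasSum⟩
  · rw [ContinuousLinearMap.isSelfAdjoint_iff_isSymmetric]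
    exact hsa
  · ext x
    change ∑' n, P n (∑' m, P m x) = ∑' n, P n x
    simp only [hid]

theorem SWord_isom {N : ℕ} (S : Fin N → H →L[ℂ] H)
    (hiso : ∀ i j, adjoint (S i) * S j = if i = j then 1 else 0) (f : List (Fin N)) :
    adjoint (SWord S f) * SWord S f = 1 := by
  induction f with
  | nil => simp [SWord, ← ContinuousLinearMap.star_eq_adjoint]
  | cons i f ih =>
    have h := hiso i i
    rw [if_pos rfl] at h
    rw [SWord_cons]
    simp only [← ContinuousLinearMap.star_eq_adjoint, star_mul] at *
    rw [mul_assoc, ← mul_assoc (star (S i)), h, one_mul, ih]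

theorem SWord_isPr {N : ℕ} (S : Fin N → H →L[ℂ] H)
    (hiso : ∀ i j, adjoint (S i) * S j = if i = j then 1 else 0) (f : List (Fin N)) :
    IsPr (SWord S f * adjoint (SWord S f)) ∧
      ∀ x, ‖(SWord S f * adjoint (SWord S f)) x‖ = ‖adjoint (SWord S f) x‖ := by
  have h := SWord_isom S hiso f
  have hP : IsPr (SWord S f * adjoint (SWord S f)) := by
    refine ⟨?_, ?_⟩
    · rw [← ContinuousLinearMap.star_eq_adjoint]
      exact IsSelfAdjoint.mul_star_self _
    · rw [mul_assoc, ← mul_assoc (adjoint _), h, one_mul]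
  refine ⟨hP, fun x => ?_⟩
  have h1 := hP.norm_sq x
  have h2 : inner ℂ x ((SWord S f * adjoint (SWord S f)) x)
      = ((‖adjoint (SWord S f) x‖ ^ 2 : ℝ) : ℂ) := by
    rw [← inner_self_C, ContinuousLinearMap.adjoint_inner_left]
    rfl
  rw [h2] at h1
  have h3 : ‖adjoint (SWord S f) x‖ ^ 2 = ‖(SWord S f * adjoint (SWord S f)) x‖ ^ 2 := by
    exact_mod_cast h1
  exact ((sq_eq_sq₀ (norm_nonneg _) (norm_nonneg _)).1 h3).symm

theorem good_iUnion {X : Type*} [MeasurableSpace X] (μ : H → MeasureTheory.Measure X)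
    (hμ : ∀ h, μ h Set.univ = ENNReal.ofReal (‖h‖ ^ 2))
    (E : ℕ → Set X) (hE : ∀ n, MeasurableSet (E n)) (hd : Pairwise (Function.onFun Disjoint E))
    (P : ℕ → H →L[ℂ] H) (hP : ∀ n, IsPr (P n))
    (hPμ : ∀ n h, μ h (E n) = ENNReal.ofReal (‖P n h‖ ^ 2)) :
    ∃ T : H →L[ℂ] H, IsPr T ∧ (∀ x, HasSum (fun n => P n x) (T x)) ∧
      ∀ h, μ h (⋃ n, E n) = ENNReal.ofReal (‖T h‖ ^ 2) := by
  have ho : ∀ m n, m ≠ n → ∀ x, P m (P n x) = 0 := by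
    intro m n hmn x
    have h1 := MeasureTheory.measure_union (μ := μ (P n x)) (hd hmn) (hE n)
    have h2 := MeasureTheory.measure_mono (μ := μ (P n x)) (Set.subset_univ (E m ∪ E n))
    rw [h1, hPμ, hPμ, hμ, (hP n).app, ← ENNReal.ofReal_add (by positivity) (by positivity),
      ENNReal.ofReal_le_ofReal_iff (by positivity)] at h2
    have h3 : ‖P m (P n x)‖ ^ 2 ≤ 0 := by linarith
    have h4 : ‖P m (P n x)‖ = 0 := by nlinarith [norm_nonneg (P m (P n x))]
    exact norm_eq_zero.1 h4
  have hU : ∀ x, μ x (⋃ n, E n) = ∑' n, ENNReal.ofReal (‖P n x‖ ^ 2) := by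
    intro x
    rw [MeasureTheory.measure_iUnion hd hE]
    simp only [hPμ]
  have hs : ∀ x, Summable fun n => ‖P n x‖ ^ 2 := by
    intro x
    have h1 : ∑' n, ENNReal.ofReal (‖P n x‖ ^ 2) ≠ ⊤ := by
      rw [← hU]
      refine ne_top_of_le_ne_top ?_ (MeasureTheory.measure_mono (Set.subset_univ _))
      rw [hμ]; exact ENNReal.ofReal_ne_top
    refine (ENNReal.summable_toReal h1).congr fun n => ?_
    rw [ENNReal.toReal_ofReal (by positivity)]
  obtain ⟨T, hT, hTs⟩ := exists_sum_proj P hP ho hs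
  refine ⟨T, hT, hTs, fun x => ?_⟩
  have h1 : HasSum (fun n => inner ℂ x (P n x)) (inner ℂ x (T x)) :=
    (innerSL ℂ x).hasSum (hTs x)
  simp only [(hP _).norm_sq, hT.norm_sq] at h1
  have h2 : HasSum (fun n => ‖P n x‖ ^ 2) (‖T x‖ ^ 2) := by exact_mod_cast h1
  rw [hU, ← h2.tsum_eq, ENNReal.ofReal_tsum_of_nonneg (fun n => by positivity) (hs x)]

theorem pvm_compl {N : ℕ} {Q : Set (ℕ → Fin N) → H →L[ℂ] H} (hQ : IsProjValuedMeasure Q)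
    (E : Set (ℕ → Fin N)) (hE : @MeasurableSet _ (cylinderSigma N) E) : Q Eᶜ = 1 - Q E := by
  obtain ⟨-, h0, h1, hadd⟩ := hQ
  let F : ℕ → Set (ℕ → Fin N) := fun n => if n = 0 then E else if n = 1 then Eᶜ else ∅
  have hF0 : F 0 = E := rfl
  have hF1 : F 1 = Eᶜ := rfl
  have hF2 : ∀ n, n ≠ 0 → n ≠ 1 → F n = ∅ := fun n h h' => by simp [F, h, h']
  have hU : ⋃ n, F n = Set.univ := by
    refine Set.eq_univ_of_forall fun x => Set.mem_iUnion.2 ?_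
    by_cases hx : x ∈ E
    · exact ⟨0, hx⟩
    · exact ⟨1, hx⟩
  have hFm : ∀ n, @MeasurableSet _ (cylinderSigma N) (F n) := by
    intro n
    by_cases hn : n = 0
    · subst hn; exact hE
    by_cases hn' : n = 1
    · subst hn'; exact hE.compl
    rw [hF2 n hn hn']; exact @MeasurableSet.empty _ (cylinderSigma N)
  have hFd : Pairwise (Function.onFun Disjoint F) := by
    intro m n hmn
    rw [Function.onFun, Set.disjoint_left]
    intro x hm hn
    simp only [F] at hm hn
    split_ifs at hm hn <;> first | omega | simp_all
  ext x
  have h2 := hadd F hFm hFd x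
  rw [hU, h1] at h2
  have h3 : HasSum (fun n => Q (F n) x) (∑ n ∈ ({0, 1} : Finset ℕ), Q (F n) x) := by
    apply hasSum_sum_of_ne_finset_zero
    intro n hn
    simp only [Finset.mem_insert, Finset.mem_singleton, not_or] at hn
    rw [hF2 n hn.1 hn.2, h0]; rfl
  have h4 := h2.unique h3
  rw [Finset.sum_pair (by norm_num), hF0, hF1] at h4
  change Q Eᶜ x = x - Q E x
  change x = Q E x + Q Eᶜ x at h4
  exact eq_sub_of_add_eq' h4.symm

end CuntzAux

/-- For every representation of the Cuntz algebra `𝒪_N` there exists a unique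
projection-valued measure `Q_π` on `(Ω_N, 𝒞)` with `Q_π(E_f) = S_f S_f^*` for every
nonempty finite word `f`. -/
theorem cuntz_projection_valued_measure_exists_unique
    {H : Type*} [NormedAddCommGroup H] [InnerProductSpace ℂ H] [CompleteSpace H]
    (N : ℕ) (hN : 2 ≤ N) (S : Fin N → H →L[ℂ] H)
    (hiso : ∀ i j, adjoint (S i) * S j = if i = j then 1 else 0)
    (hsum : ∑ i, S i * adjoint (S i) = 1) :
    ∃ Q : Set (ℕ → Fin N) → H →L[ℂ] H,
      (IsProjValuedMeasure Q ∧
        ∀ f : List (Fin N), f ≠ [] → Q (cylinder f) = SWord S f * adjoint (SWord S f)) ∧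
      ∀ Q' : Set (ℕ → Fin N) → H →L[ℂ] H,
        (IsProjValuedMeasure Q' ∧
          ∀ f : List (Fin N), f ≠ [] → Q' (cylinder f) = SWord S f * adjoint (SWord S f)) →
        ∀ E, @MeasurableSet _ (cylinderSigma N) E → Q' E = Q E := by
  classical
  choose μ hμ using exists_mu S (⟨0, by omega⟩ : Fin N) hsum
  have hμu : ∀ h, μ h Set.univ = ENNReal.ofReal (‖h‖ ^ 2) := by
    intro h
    rw [← cylinder_nil, hμ]
    have : adjoint (SWord S ([] : List (Fin N))) = 1 := by
      simp [SWord, ← ContinuousLinearMap.star_eq_adjoint]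
    rw [this]; rfl
  have hle := cylinderSigma_le N
  have good : ∀ E, @MeasurableSet _ (cylinderSigma N) E → ∃ P : H →L[ℂ] H, IsPr P ∧
      ∀ h, μ h E = ENNReal.ofReal (‖P h‖ ^ 2) := by
    intro E hE
    refine MeasurableSpace.induction_on_inter (m := cylinderSigma N)
      (C := fun E _ => ∃ P : H →L[ℂ] H, IsPr P ∧ ∀ h, μ h E = ENNReal.ofReal (‖P h‖ ^ 2))
      rfl (isPiSystem_cyl N) ?_ ?_ ?_ ?_ E hE
    · exact ⟨0, ⟨IsSelfAdjoint.zero _, by simp⟩, by simp⟩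
    · rintro _ ⟨f, hf, rfl⟩
      obtain ⟨h1, h2⟩ := SWord_isPr S hiso f
      exact ⟨_, h1, fun h => by rw [hμ, h2]⟩
    · rintro t ht ⟨P, hP, hPμ⟩
      refine ⟨1 - P, hP.one_sub, fun h => ?_⟩
      rw [MeasureTheory.measure_compl (hle _ ht) (by rw [hPμ]; exact ENNReal.ofReal_ne_top),
        hμu, hPμ, ← ENNReal.ofReal_sub _ (by positivity), ← hP.norm_one_sub h, add_sub_cancel_right]
    · intro F hd hF hC
      choose P hP hPμ using hC
      obtain ⟨T, hT, -, hTμ⟩ := good_iUnion μ hμu F (fun n => hle _ (hF n)) hd P hP hPμ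
      exact ⟨T, hT, hTμ⟩
  choose! Q hQ hQμ using good
  have huniq : ∀ E, @MeasurableSet _ (cylinderSigma N) E → ∀ P : H →L[ℂ] H, IsPr P →
      (∀ h, μ h E = ENNReal.ofReal (‖P h‖ ^ 2)) → Q E = P := by
    intro E hE P hP hPμ
    refine (hQ E hE).ext_norm hP fun x => ?_
    have h1 := hPμ x
    rw [hQμ E hE x] at h1
    exact (ENNReal.ofReal_eq_ofReal_iff (by positivity) (by positivity)).1 h1
  have hcm : ∀ f : List (Fin N), f ≠ [] → @MeasurableSet _ (cylinderSigma N) (cylinder f) :=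
    fun f hf => MeasurableSpace.measurableSet_generateFrom ⟨f, hf, rfl⟩
  have hpvm : IsProjValuedMeasure Q := by
    refine ⟨hQ, ?_, ?_, ?_⟩
    · exact huniq _ (@MeasurableSet.empty _ (cylinderSigma N)) _
        ⟨IsSelfAdjoint.zero _, by simp⟩ (by simp)
    · exact huniq _ (@MeasurableSet.univ _ (cylinderSigma N)) _
        ⟨IsSelfAdjoint.one _, by simp⟩ (by simpa using hμu)
    · intro E hE hd h
      obtain ⟨T, hT, hTs, hTμ⟩ := good_iUnion μ hμu E (fun n => hle _ (hE n)) hd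
        (fun n => Q (E n)) (fun n => hQ _ (hE n)) (fun n => hQμ _ (hE n))
      rw [huniq _ (@MeasurableSet.iUnion _ _ (cylinderSigma N) _ _ hE) T hT hTμ]
      exact hTs h
  have hcyl : ∀ f : List (Fin N), f ≠ [] →
      Q (cylinder f) = SWord S f * adjoint (SWord S f) := by
    intro f hf
    obtain ⟨h1, h2⟩ := SWord_isPr S hiso f
    exact huniq _ (hcm f hf) _ h1 (fun h => by rw [hμ, h2])
  refine ⟨Q, ⟨hpvm, hcyl⟩, ?_⟩
  rintro Q' ⟨hpvm', hcyl'⟩ E hE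
  refine MeasurableSpace.induction_on_inter (m := cylinderSigma N)
    (C := fun E _ => Q' E = Q E) rfl (isPiSystem_cyl N) ?_ ?_ ?_ ?_ E hE
  · rw [hpvm.2.1, hpvm'.2.1]
  · rintro _ ⟨f, hf, rfl⟩
    rw [hcyl f hf, hcyl' f hf]
  · intro t ht h
    rw [pvm_compl hpvm t ht, pvm_compl hpvm' t ht, h]
  · intro F hd hF h
    ext x
    have h1 := hpvm.2.2.2 F hF hd x
    have h2 := hpvm'.2.2.2 F hF hd x
    simp only [h] at h2
    exact h2.unique h1
end

section
/- Let S_1,…,S_N be a representation of the Cuntz algebra 𝒪_N on ℋ, and let α be a unital *-algebra endomorphism of B(ℋ) (linear, multiplicative, star-preserving, with α(I) = I). Then: (1) a unitary operator U on ℋ satisfies U S_i = α(S_i) for all 1 ≤ i ≤ N if and only if U = ∑_{i=1}^N α(S_i) S_i*; and (2) the operator U_α := ∑_{i=1}^N α(S_i) S_i* is always a unitary operator on ℋ, i.e., U_α U_α* = U_α* U_α = I. -/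
open ContinuousLinearMap

/-- For a representation of the Cuntz algebra `𝒪_N` and a unital *-algebra endomorphism
`α` of `B(ℋ)`: (1) a unitary `U` satisfies `U S_i = α(S_i)` for all `i` iff
`U = ∑_i α(S_i) S_i^*`; (2) `U_α := ∑_i α(S_i) S_i^*` is always unitary. -/
theorem cuntz_endomorphism_unitary
    {H : Type*} [NormedAddCommGroup H] [InnerProductSpace ℂ H] [CompleteSpace H]
    (N : ℕ) (hN : 2 ≤ N) (S : Fin N → H →L[ℂ] H)
    (hiso : ∀ i j, adjoint (S i) * S j = if i = j then 1 else 0)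
    (hsum : ∑ i, S i * adjoint (S i) = 1)
    (α : (H →L[ℂ] H) → (H →L[ℂ] H))
    (hadd : ∀ A B, α (A + B) = α A + α B)
    (hsmul : ∀ (c : ℂ) (A), α (c • A) = c • α A)
    (hmul : ∀ A B, α (A * B) = α A * α B)
    (hstar : ∀ A, α (adjoint A) = adjoint (α A))
    (hone : α 1 = 1) :
    (∀ U : H →L[ℂ] H, U * adjoint U = 1 → adjoint U * U = 1 →
      ((∀ i : Fin N, U * S i = α (S i)) ↔ U = ∑ i : Fin N, α (S i) * adjoint (S i))) ∧
    ((∑ i : Fin N, α (S i) * adjoint (S i)) *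
        adjoint (∑ i : Fin N, α (S i) * adjoint (S i)) = 1 ∧
      adjoint (∑ i : Fin N, α (S i) * adjoint (S i)) *
        (∑ i : Fin N, α (S i) * adjoint (S i)) = 1) := by
  have h0 : α 0 = 0 := by
    have h := hsmul 0 0
    simpa using h
  have hV : ∀ j, (∑ i : Fin N, α (S i) * adjoint (S i)) * S j = α (S j) := by
    intro j
    rw [Finset.sum_mul]
    simp [mul_assoc, hiso]
  have hadj : adjoint (∑ i : Fin N, α (S i) * adjoint (S i))
      = ∑ i : Fin N, S i * α (adjoint (S i)) := by
    rw [map_sum]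
    refine Finset.sum_congr rfl fun i _ => ?_
    rw [hstar]
    simp only [← star_eq_adjoint, star_mul, star_star]
  have hW : ∀ j, (∑ i : Fin N, S i * α (adjoint (S i))) * α (S j) = S j := by
    intro j
    rw [Finset.sum_mul, Finset.sum_eq_single j]
    · rw [mul_assoc, ← hmul, hiso, if_pos rfl, hone, mul_one]
    · intro i _ hij
      rw [mul_assoc, ← hmul, hiso, if_neg hij, h0, mul_zero]
    · simp
  have hαsum : ∑ i : Fin N, α (S i * adjoint (S i)) = 1 := by
    let f : (H →L[ℂ] H) →+ (H →L[ℂ] H) := ⟨⟨α, h0⟩, hadd⟩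
    have h := map_sum f (fun i => S i * adjoint (S i)) Finset.univ
    rw [hsum] at h
    exact h.symm.trans hone
  refine ⟨fun U _ _ => ⟨fun h => ?_, fun h => ?_⟩, ?_, ?_⟩
  · simp_rw [← h, mul_assoc]
    rw [← Finset.mul_sum, hsum, mul_one]
  · subst h
    exact hV
  · rw [hadj, Finset.mul_sum]
    simp_rw [← mul_assoc, hV, ← hmul]
    exact hαsum
  · rw [hadj, Finset.mul_sum]
    simp_rw [← mul_assoc, hW]
    exact hsum
end

section
/- Let (M,d) be a nonempty compact metric space, τ_1,…,τ_N : M → M strict contractions, p_1,…,p_N > 0 with ∑ p_i = 1, and μ a Borel probability measure on M satisfying μ = ∑_{i=1}^N p_i (μ∘τ_i^{-1}). Assume the non-overlap condition μ(τ_i(M) ∩ τ_j(M)) = 0 for i ≠ j, that ⋃_{i=1}^N τ_i(M) = M, and that σ : M → M is a Borel map with σ ∘ τ_i = id_M for every i. Then the operators S_i on L²(M,μ) defined by S_i f = p_i^{-1/2} · χ_{τ_i(M)} · (f∘σ) are well-defined bounded operators, their adjoints are given by S_i* f = √(p_i) · (f∘τ_i), and they satisfy the Cuntz relations: S_i* S_j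 = δ_{ij} I and ∑_{i=1}^N S_i S_i* = I on L²(μ). -/
open MeasureTheory ContinuousLinearMap

section Helpers

variable {M : Type*} [MeasurableSpace M] {μ : Measure M}

/-- The operator built from a measure preserving `σ` and a set `R` such that `μ` restricted to `R`
is `c` times the image of `μ` under a section `t` of `σ`. -/
theorem cuntz_exists_op {σ t : M → M} {R : Set M} (hR : MeasurableSet R) {c : ℝ} (hc : 0 < c)
    (hσ : MeasurePreserving σ μ μ) (ht : Measurable t)
    (hst : σ ∘ t = _root_.id)
    (hres : μ.restrict R = ENNReal.ofReal c • μ.map t) :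
    ∃ S : Lp ℂ 2 μ →L[ℂ] Lp ℂ 2 μ, 
      (∀ f : Lp ℂ 2 μ, (S f : M → ℂ) =ᵐ[μ] fun x =>
          ((Real.sqrt c : ℂ))⁻¹ * Set.indicator R (fun _ => (1 : ℂ)) x * f (σ x)) ∧
      (∀ f : Lp ℂ 2 μ,
        (adjoint S f : M → ℂ) =ᵐ[μ] fun x => (Real.sqrt c : ℂ) * f (t x)) := by
  have hst' : ∀ x, σ (t x) = x := fun x => congrFun hst x
  have hc0 : ENNReal.ofReal c ≠ 0 := by simpa using hc
  have hmap : μ.map t ≤ (ENNReal.ofReal c)⁻¹ • μ := by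
    have h1 : μ.map t = (ENNReal.ofReal c)⁻¹ • μ.restrict R := by
      rw [hres, smul_smul, ENNReal.inv_mul_cancel hc0 ENNReal.ofReal_ne_top, one_smul]
    rw [h1]
    gcongr
    exact Measure.restrict_le_self
  have hqt : Measure.QuasiMeasurePreserving t μ μ :=
    ⟨ht, Measure.absolutelyContinuous_of_le_smul hmap⟩
  have hmemA : ∀ f : Lp ℂ 2 μ, MemLp (fun x => (Real.sqrt c : ℂ) * f (t x)) 2 μ := by
    intro f
    have h1 : MemLp f 2 (μ.map t) :=
      (Lp.memLp f).of_measure_le_smul (by simpa using hc) hmap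
    exact (h1.comp_of_map ht.aemeasurable).const_mul _
  have hmem : ∀ f : Lp ℂ 2 μ, MemLp (fun x =>
      ((Real.sqrt c : ℂ))⁻¹ * Set.indicator R (fun _ => (1 : ℂ)) x * f (σ x)) 2 μ := by
    intro f
    have h1 : MemLp (fun x => f (σ x)) 2 μ := (Lp.memLp f).comp_measurePreserving hσ
    have h2 := (h1.indicator hR).const_mul ((Real.sqrt c : ℂ))⁻¹
    convert h2 using 2 with x
    by_cases hx : x ∈ R <;> simp [hx]
  let L : Lp ℂ 2 μ →ₗ[ℂ] Lp ℂ 2 μ :=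
    { toFun := fun f => (hmem f).toLp _
      map_add' := by
        intro f g
        apply Lp.ext
        filter_upwards [(hmem (f + g)).coeFn_toLp, (hmem f).coeFn_toLp, (hmem g).coeFn_toLp,
          Lp.coeFn_add ((hmem f).toLp _) ((hmem g).toLp _),
          hσ.quasiMeasurePreserving.ae (Lp.coeFn_add f g)] with x h1 h2 h3 h4 h5
        rw [h1, h4, Pi.add_apply, h2, h3, h5, Pi.add_apply, mul_add]
      map_smul' := by
        intro a f
        apply Lp.ext
        filter_upwards [(hmem (a • f)).coeFn_toLp, (hmem f).coeFn_toLp,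
          Lp.coeFn_smul a ((hmem f).toLp _),
          hσ.quasiMeasurePreserving.ae (Lp.coeFn_smul a f)] with x h1 h2 h4 h5
        rw [h1, RingHom.id_apply, h4, Pi.smul_apply, h2, h5, Pi.smul_apply, smul_eq_mul,
          smul_eq_mul]
        ring }
  let S : Lp ℂ 2 μ →L[ℂ] Lp ℂ 2 μ := L.mkContinuous (Real.sqrt c)⁻¹ (by
    intro f
    rw [← Lp.norm_compMeasurePreserving f hσ]
    apply Lp.norm_le_mul_norm_of_ae_le_mul
    filter_upwards [(hmem f).coeFn_toLp, Lp.coeFn_compMeasurePreserving f hσ] with x h1 h2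
    change ‖(hmem f).toLp _ x‖ ≤ _
    rw [h1, h2, Function.comp_apply]
    by_cases hx : x ∈ R
    · simp [hx, abs_of_nonneg (Real.sqrt_nonneg c)]
    · simp only [hx, not_false_eq_true, Set.indicator_of_notMem, mul_zero, zero_mul, norm_zero]
      positivity)
  have hS : ∀ f : Lp ℂ 2 μ, (S f : M → ℂ) =ᵐ[μ] fun x =>
      ((Real.sqrt c : ℂ))⁻¹ * Set.indicator R (fun _ => (1 : ℂ)) x * f (σ x) :=
    fun f => (hmem f).coeFn_toLp
  refine ⟨S, hS, fun f => ?_⟩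
  have hadj : adjoint S f = (hmemA f).toLp _ := by
    refine ext_inner_right ℂ fun g => ?_
    rw [adjoint_inner_left, L2.inner_def, L2.inner_def]
    have e1 : ∫ x, inner ℂ (f x) (S g x) ∂μ =
        ∫ x in R, (Real.sqrt c : ℂ)⁻¹ * inner ℂ (f x) (g (σ x)) ∂μ := by
      rw [← integral_indicator hR]
      apply integral_congr_ae
      filter_upwards [hS g] with x h
      rw [h]
      by_cases hx : x ∈ R
      · simp [hx]; ring
      · simp [hx]
    have e2 : ∫ x, inner ℂ ((hmemA f).toLp _ x) (g x) ∂μ =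
        ∫ x, (Real.sqrt c : ℂ) * inner ℂ (f (t x)) (g (σ (t x))) ∂μ := by
      apply integral_congr_ae
      filter_upwards [(hmemA f).coeFn_toLp] with x h
      rw [h, hst']
      simp
      ring
    rw [e1, e2, hres, integral_smul_measure, integral_map ht.aemeasurable,
      integral_const_mul, integral_const_mul, ENNReal.toReal_ofReal hc.le]
    · rw [Complex.real_smul, ← mul_assoc]
      congr 1
      rw [← Complex.ofReal_inv, ← Complex.ofReal_mul]
      congr 1
      rw [← div_eq_mul_inv, Real.div_sqrt]
    · have hm : AEStronglyMeasurable
          (fun x => (Real.sqrt c : ℂ)⁻¹ * inner ℂ (f x) (g (σ x))) μ := by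
        have h1 : AEStronglyMeasurable (fun x => g (σ x)) μ :=
          (Lp.aestronglyMeasurable g).comp_quasiMeasurePreserving hσ.quasiMeasurePreserving
        exact ((Lp.aestronglyMeasurable f).inner h1).const_mul _
      exact hm.mono_ac hqt.absolutelyContinuous
  rw [hadj]
  exact (hmemA f).coeFn_toLp

end Helpers

/-- For an iterated function system `τ₁,…,τ_N` of strict contractions on a compact
metric space with weights `p₁,…,p_N` and self-similar measure `μ`, assuming
non-overlap, `⋃ᵢ τᵢ(M) = M`, and `σ ∘ τᵢ = id`, the operators
`Sᵢ f = pᵢ^{-1/2} χ_{τᵢ(M)} (f ∘ σ)` are well-defined bounded operators on `L²(μ)`,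
their adjoints are `Sᵢ* f = √pᵢ (f ∘ τᵢ)`, and they satisfy the Cuntz relations. -/
theorem ifs_cuntz_representation
    {M : Type*} [MetricSpace M] [CompactSpace M] [Nonempty M]
    [MeasurableSpace M] [BorelSpace M]
    (N : ℕ) (hN : 2 ≤ N) (τ : Fin N → M → M)
    (hτ : ∀ i, ∃ c : NNReal, c < 1 ∧ LipschitzWith c (τ i))
    (p : Fin N → ℝ) (hp : ∀ i, 0 < p i) (hpsum : ∑ i, p i = 1)
    (μ : Measure M) [IsProbabilityMeasure μ]
    (hself : ∀ B : Set M, MeasurableSet B →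
      μ B = ∑ i : Fin N, ENNReal.ofReal (p i) * μ (τ i ⁻¹' B))
    (hno : ∀ i j : Fin N, i ≠ j → μ (Set.range (τ i) ∩ Set.range (τ j)) = 0)
    (hcover : (⋃ i : Fin N, Set.range (τ i)) = Set.univ)
    (σ : M → M) (hσ : Measurable σ) (hστ : ∀ i, σ ∘ τ i = _root_.id) :
    ∃ S : Fin N → (Lp ℂ 2 μ →L[ℂ] Lp ℂ 2 μ),
      (∀ (i : Fin N) (f : Lp ℂ 2 μ),
        (S i f : M → ℂ) =ᵐ[μ] fun x =>
          ((Real.sqrt (p i) : ℂ))⁻¹ *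
            Set.indicator (Set.range (τ i)) (fun _ => (1 : ℂ)) x * f (σ x)) ∧
      (∀ (i : Fin N) (f : Lp ℂ 2 μ),
        (adjoint (S i) f : M → ℂ) =ᵐ[μ] fun x => (Real.sqrt (p i) : ℂ) * f (τ i x)) ∧
      (∀ i j : Fin N, adjoint (S i) * S j = if i = j then 1 else 0) ∧
      (∑ i : Fin N, S i * adjoint (S i)) = 1 := by
  classical
  have hcont : ∀ i, Continuous (τ i) := fun i => by
    obtain ⟨c, _, h⟩ := hτ i
    exact h.continuous
  have hmeas : ∀ i, Measurable (τ i) := fun i => (hcont i).measurable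
  have hR : ∀ i, MeasurableSet (Set.range (τ i)) := fun i =>
    (isCompact_range (hcont i)).isClosed.measurableSet
  have hστ' : ∀ i x, σ (τ i x) = x := fun i x => congrFun (hστ i) x
  have hσm : MeasurePreserving σ μ μ := by
    refine ⟨hσ, ?_⟩
    ext B hB
    rw [Measure.map_apply hσ hB, hself _ (hσ hB)]
    have : ∀ i, τ i ⁻¹' (σ ⁻¹' B) = B := fun i => by
      ext x; simp [hστ']
    simp only [this]
    rw [← Finset.sum_mul, ← ENNReal.ofReal_sum_of_nonneg (fun i _ => (hp i).le), hpsum]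
    simp
  have hle : ∀ i B, MeasurableSet B → μ B = 0 → μ (τ i ⁻¹' B) = 0 := by
    intro i B hB h0
    rw [hself B hB, Finset.sum_eq_zero_iff] at h0
    have := h0 i (Finset.mem_univ i)
    simpa [(hp i).not_ge] using this
  have hcross : ∀ i j, i ≠ j → μ (τ j ⁻¹' (Set.range (τ i))) = 0 := by
    intro i j hij
    have := hle j _ ((hR i).inter (hR j)) (hno i j hij)
    refine measure_mono_null ?_ this
    intro x hx
    exact ⟨hx, x, rfl⟩
  have hres : ∀ i, μ.restrict (Set.range (τ i)) = ENNReal.ofReal (p i) • μ.map (τ i) := by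
    intro i
    ext B hB
    rw [Measure.restrict_apply hB, hself _ (hB.inter (hR i)), Finset.sum_eq_single i]
    · rw [Measure.smul_apply, Measure.map_apply (hmeas i) hB, smul_eq_mul]
      congr 2
      ext x; simp
    · intro j _ hj
      rw [measure_mono_null _ (hcross i j hj.symm), mul_zero]
      intro x hx
      exact hx.2
    · simp
  have hqt : ∀ i, Measure.QuasiMeasurePreserving (τ i) μ μ := fun i =>
    ⟨hmeas i, Measure.AbsolutelyContinuous.mk fun s hs h0 => by
      rw [Measure.map_apply (hmeas i) hs]; exact hle i s hs h0⟩
  choose S hS hSa using fun i => cuntz_exists_op (hR i) (hp i) hσm (hmeas i) (hστ i) (hres i)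
  have hsq : ∀ i, (Real.sqrt (p i) : ℂ) ≠ 0 := fun i => by
    exact_mod_cast (Real.sqrt_pos.2 (hp i)).ne'
  refine ⟨S, hS, hSa, ?_, ?_⟩
  · intro i j
    ext1 f
    apply Lp.ext
    rw [mul_apply_eq_comp]
    have h1 := hSa i (S j f)
    have h2 := (hqt i).ae (hS j f)
    by_cases hij : i = j
    · subst hij
      rw [if_pos rfl, one_apply_eq_self]
      filter_upwards [h1, h2] with x h1 h2
      rw [h1, h2, hστ', Set.indicator_of_mem (Set.mem_range_self x)]
      field_simp [hsq i]
    · rw [if_neg hij, _root_.zero_apply]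
      have h3 : ∀ᵐ x ∂μ, τ i x ∉ Set.range (τ j) :=
        measure_eq_zero_iff_ae_notMem.1 (hcross j i (Ne.symm hij))
      filter_upwards [h1, h2, h3, Lp.coeFn_zero ℂ 2 μ] with x h1 h2 h3 h4
      rw [h1, h2, h4, Set.indicator_of_notMem h3]
      simp
  · ext1 f
    apply Lp.ext
    rw [_root_.sum_apply, one_apply_eq_self]
    have h1 : ∀ᵐ x ∂μ, ∀ i, (S i (adjoint (S i) f) : M → ℂ) x =
        Set.indicator (Set.range (τ i)) (fun _ => (1 : ℂ)) x * f x := by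
      rw [ae_all_iff]
      intro i
      filter_upwards [hS i (adjoint (S i) f), hσm.quasiMeasurePreserving.ae (hSa i f)] with x h1 h2
      rw [h1, h2]
      by_cases hx : x ∈ Set.range (τ i)
      · obtain ⟨y, rfl⟩ := hx
        rw [hστ', Set.indicator_of_mem (Set.mem_range_self y)]
        field_simp [hsq i]
      · rw [Set.indicator_of_notMem hx]; simp
    have h2 : ∀ᵐ x ∂μ, ∀ i j, i ≠ j → x ∉ Set.range (τ i) ∩ Set.range (τ j) := by
      simp only [ae_all_iff]
      intro i j hij
      exact measure_eq_zero_iff_ae_notMem.1 (hno i j hij)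
    have h3 := Lp.coeFn_finsetSum Finset.univ (fun i => S i (adjoint (S i) f))
    filter_upwards [h1, h2, h3] with x h1 h2 h3
    simp only [mul_apply_eq_comp]
    rw [h3, Finset.sum_apply]
    simp only [h1]
    have hx : x ∈ ⋃ i, Set.range (τ i) := hcover ▸ Set.mem_univ x
    obtain ⟨i, hi⟩ := Set.mem_iUnion.1 hx
    rw [Finset.sum_eq_single i]
    · rw [Set.indicator_of_mem hi, one_mul]
    · intro j _ hj
      rw [Set.indicator_of_notMem fun h => h2 j i hj ⟨h, hi⟩, zero_mul]
    · simp
end
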